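/- Let r_1, ..., r_{K+1} be positive reals with r_j = ρ(Φ^j(z))/ρ(z) for a reversible Φ and F-invariant positive ρ. Define the LAHMC probabilities recursively by π^{(k)}(z) = min(1 − Σ_{j<k} π^{(j)}(z), (ρ(F Φ^k(z))/ρ(z))·(1 − Σ_{j<k} π^{(j)}(F Φ^k(z)))) and S^{(k)}(z) = Σ_{j ≤ k} π^{(j)}(z). Then for every k = 1, ..., K+1 and every z, S^{(k)}(z) = min(1, max_{1 ≤ j ≤ k} ρ(Φ^j(z))/ρ(z)), i.e. the LAHMC accumulated probabilities coincide with the XCGHMC accumulated probabilities Σ^{(k)}(z). -/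

import Mathlib

theorem sup_div_aux (s : Finset ℕ) (hs : s.Nonempty) (f : ℕ → ℝ) (c : ℝ) (hc : 0 < c) :
    s.sup' hs (fun j => f j / c) = s.sup' hs f / c := by
  apply le_antisymm
  · apply Finset.sup'_le
    intro j hj
    exact div_le_div_of_nonneg_right (Finset.le_sup' f hj) hc.le
  · rw [div_le_iff₀ hc]
    apply Finset.sup'_le
    intro j hj
    rw [← div_le_iff₀ hc]
    exact Finset.le_sup' (fun j => f j / c) hj

theorem sup_refl_aux (k : ℕ) (hs : (Finset.Icc 1 k).Nonempty) (f g : ℕ → ℝ)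
    (h : ∀ j ∈ Finset.Icc 1 k, f j = g (k + 1 - j)) :
    (Finset.Icc 1 k).sup' hs f ≤ (Finset.Icc 1 k).sup' hs g := by
  apply Finset.sup'_le
  intro j hj
  rw [h j hj]
  apply Finset.le_sup' g
  simp only [Finset.mem_Icc] at hj ⊢
  omega

theorem arith_aux (a b m : ℝ) (ha : 0 < a) (hb : 0 < b) :
    min 1 (m / a) + min (1 - min 1 (m / a)) (b / a * (1 - min 1 (m / b)))
      = min 1 (max (m / a) (b / a)) := by
  have h1 : b / a * (1 - min 1 (m / b)) = max 0 (b / a - m / a) := by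
    rcases le_total m b with h | h
    · rw [min_eq_right ((div_le_one hb).2 h), max_eq_right]
      · field_simp
      · exact sub_nonneg.2 (div_le_div_of_nonneg_right h ha.le)
    · rw [min_eq_left ((one_le_div hb).2 h), max_eq_left]
      · simp
      · exact sub_nonpos.2 (div_le_div_of_nonneg_right h ha.le)
  rw [h1]
  generalize m / a = x
  generalize b / a = y
  grind

theorem lahmc_equals_xcghmc (d K : ℕ) (hd : 1 ≤ d)
    (Φ : ((Fin d → ℝ) × (Fin d → ℝ)) ≃ ((Fin d → ℝ) × (Fin d → ℝ)))
    (F : (Fin d → ℝ) × (Fin d → ℝ) → (Fin d → ℝ) × (Fin d → ℝ))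
    (hF : ∀ z, F z = (z.1, -z.2))
    (hrev : ∀ z, Φ.symm z = F (Φ (F z)))
    (ρ : (Fin d → ℝ) × (Fin d → ℝ) → ℝ)
    (hρpos : ∀ z, 0 < ρ z)
    (hρF : ∀ z, ρ (F z) = ρ z)
    (π : ℕ → ((Fin d → ℝ) × (Fin d → ℝ)) → ℝ)
    (hπ : ∀ k, 1 ≤ k → k ≤ K + 1 → ∀ z,
      π k z = min (1 - ∑ j ∈ Finset.Icc 1 (k - 1), π j z)
        ((ρ (F ((⇑Φ)^[k] z)) / ρ z) *
          (1 - ∑ j ∈ Finset.Icc 1 (k - 1), π j (F ((⇑Φ)^[k] z))))) :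
    ∀ k (hk : 1 ≤ k), k ≤ K + 1 → ∀ z,
      (∑ j ∈ Finset.Icc 1 k, π j z) =
        min 1 ((Finset.Icc 1 k).sup' (Finset.nonempty_Icc.mpr hk)
          fun j => ρ ((⇑Φ)^[j] z) / ρ z) := by
  have hFF : ∀ z, F (F z) = z := by
    intro z
    simp [hF]
  have hstep : ∀ y, Φ (F (Φ y)) = F y := by
    intro y
    have h := hrev (F y)
    rw [hFF] at h
    rw [← h, Equiv.apply_symm_apply]
  have hiter : ∀ j i z, (⇑Φ)^[j] (F ((⇑Φ)^[j + i] z)) = F ((⇑Φ)^[i] z) := by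
    intro j
    induction j with
    | zero => intro i z; simp
    | succ j ih =>
      intro i z
      have e : j + 1 + i = (j + i) + 1 := by omega
      rw [Function.iterate_succ_apply, e, Function.iterate_succ_apply' _ (j + i), hstep, ih]
  intro k hk
  induction k, hk using Nat.le_induction with
  | base =>
    intro h z
    have := hπ 1 le_rfl h z
    simp at this
    simp [this, hρF]
  | succ k hk ih =>
    intro hK z
    have hne : (Finset.Icc 1 k).Nonempty := Finset.nonempty_Icc.mpr hk
    have ih' := ih (by omega)
    rw [Finset.sum_Icc_succ_top (by omega), hπ (k + 1) (by omega) hK z, Nat.add_sub_cancel,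
      ih' z, ih' (F ((⇑Φ)^[k + 1] z))]
    have hw : ∀ j ∈ Finset.Icc 1 k, ρ ((⇑Φ)^[j] (F ((⇑Φ)^[k + 1] z)))
        = ρ ((⇑Φ)^[k + 1 - j] z) := by
      intro j hj
      simp only [Finset.mem_Icc] at hj
      have := hiter j (k + 1 - j) z
      rw [show j + (k + 1 - j) = k + 1 by omega] at this
      rw [this, hρF]
    have hm : (Finset.Icc 1 k).sup' hne (fun j => ρ ((⇑Φ)^[j] (F ((⇑Φ)^[k + 1] z))))
        = (Finset.Icc 1 k).sup' hne (fun j => ρ ((⇑Φ)^[j] z)) := by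
      apply le_antisymm
      · exact sup_refl_aux k hne _ _ hw
      · apply sup_refl_aux k hne
        intro j hj
        simp only [Finset.mem_Icc] at hj
        have := hw (k + 1 - j) (by simp only [Finset.mem_Icc]; omega)
        rw [this, show k + 1 - (k + 1 - j) = j by omega]
    rw [sup_div_aux _ _ (fun j => ρ ((⇑Φ)^[j] z)) _ (hρpos _),
      sup_div_aux _ _ (fun j => ρ ((⇑Φ)^[j] (F ((⇑Φ)^[k + 1] z)))) _ (hρpos _), hm,
      arith_aux _ _ _ (hρpos _) (hρpos _),
      ← sup_div_aux _ _ (fun j => ρ ((⇑Φ)^[j] z)) _ (hρpos _), hρF]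
    congr 1
    have hI : Finset.Icc 1 (k + 1) = insert (k + 1) (Finset.Icc 1 k) := by
      ext j
      simp only [Finset.mem_Icc, Finset.mem_insert]
      omega
    rw [Finset.sup'_congr _ hI (fun _ _ => rfl), Finset.sup'_insert, max_comm]
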